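/- arXiv:math/0609702 — 4 statements merged into one kernel-verified Lean document; each statement's English description precedes it below -/
import Mathlib

section
/- There is a sequence of pairs (P1^n, P2^n)_{n≥1} of finite ordered sets such that: (1) P1^n is not order-isomorphic to P2^n; (2) P1^n and P2^n have equal marked maximal decks and equal marked minimal decks; (3) there are ranks k_0,…,k_n such that P1^n and P2^n have equal marked rank k_i decks for each i=0,…,n; (4) for every pair of isomorphic cards P1^n∖{x} and P2^n∖{y} arising in (2) and (3), the neighborhoods ↕x in P1^n and ↕y in P2^n are order-isomorphic; (5) there are at most four ranks r for which no element x of rank r in P1^n and element y of rank r in P2^n satisfy that P1^n∖{x} is order-isomorphic to P2^n∖{y}; (6) liminf_{n→∞} ECR(P1^n, P2^n) ≥ 1/10; (7) for every rank k, P1^n and P2^n have equal rank k neighborhood decks. -/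
/-- A finite ordered set: a type equipped with a partial order and a `Fintype` structure. -/
structure FinPoset where
  carrier : Type
  [po : PartialOrder carrier]
  [ft : Fintype carrier]

instance : CoeSort FinPoset Type := ⟨FinPoset.carrier⟩
attribute [instance] FinPoset.po FinPoset.ft

/-- The card of an ordered set obtained by deleting the point `x`,
as an induced subposet. -/
abbrev Card (P : Type*) [PartialOrder P] (x : P) : Type _ := {y : P // y ≠ x}

/-- The neighborhood `↕x = {y : y ≤ x or y ≥ x}` of a point `x`,
as an induced subposet. -/
abbrev Nbhd (P : Type*) [PartialOrder P] (x : P) : Type _ := {y : P // y ≤ x ∨ x ≤ y}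

/-- `P` and `P'` have equal marked maximal decks (via a correspondence under which,
in addition, the neighborhoods of corresponding removed points are isomorphic):
a bijection `σ` between the maximal elements such that each maximal card `P∖{m}` is
isomorphic to `P'∖{σ m}` via an isomorphism mapping maximal elements to maximal
elements, and `↕m ≅ ↕(σ m)`. -/
def EqualMarkedMaxDecksWithNbhds (P P' : Type*) [PartialOrder P] [PartialOrder P'] : Prop :=
  ∃ σ : {x : P // IsMax x} ≃ {y : P' // IsMax y},
    ∀ m : {x : P // IsMax x},
      (∃ Φ : Card P m.val ≃o Card P' (σ m).val,
        ∀ z : Card P m.val, IsMax z.val → IsMax (Φ z).val) ∧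
      Nonempty (Nbhd P m.val ≃o Nbhd P' (σ m).val)

/-- Equal marked minimal decks, with isomorphic neighborhoods of corresponding
removed points; dual to `EqualMarkedMaxDecksWithNbhds`. -/
def EqualMarkedMinDecksWithNbhds (P P' : Type*) [PartialOrder P] [PartialOrder P'] : Prop :=
  ∃ σ : {x : P // IsMin x} ≃ {y : P' // IsMin y},
    ∀ m : {x : P // IsMin x},
      (∃ Φ : Card P m.val ≃o Card P' (σ m).val,
        ∀ z : Card P m.val, IsMin z.val → IsMin (Φ z).val) ∧
      Nonempty (Nbhd P m.val ≃o Nbhd P' (σ m).val)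

/-- `P` and `P'` have equal marked rank `k` decks (via a correspondence under which,
in addition, the neighborhoods of corresponding removed points are isomorphic):
a bijection `σ` between the rank-`k` elements such that each card `P∖{x}` is
isomorphic to `P'∖{σ x}` via a rank-preserving isomorphism, and `↕x ≅ ↕(σ x)`.
(The rank of an element is `Order.height`.) -/
def EqualMarkedRankDecksWithNbhds (P P' : Type*) [PartialOrder P] [PartialOrder P']
    (k : ℕ) : Prop :=
  ∃ σ : {x : P // Order.height x = (k : ℕ∞)} ≃ {y : P' // Order.height y = (k : ℕ∞)},
    ∀ x : {x : P // Order.height x = (k : ℕ∞)},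
      (∃ Φ : Card P x.val ≃o Card P' (σ x).val,
        ∀ z : Card P x.val, Order.height (Φ z).val = Order.height z.val) ∧
      Nonempty (Nbhd P x.val ≃o Nbhd P' (σ x).val)

/-- `P` and `P'` have equal rank `k` neighborhood decks: a bijection `σ` between the
rank-`k` elements with `↕x ≅ ↕(σ x)` for every rank-`k` element `x`. -/
def EqualRankNbhdDecks (P P' : Type*) [PartialOrder P] [PartialOrder P'] (k : ℕ) : Prop :=
  ∃ σ : {x : P // Order.height x = (k : ℕ∞)} ≃ {y : P' // Order.height y = (k : ℕ∞)},
    ∀ x : {x : P // Order.height x = (k : ℕ∞)}, Nonempty (Nbhd P x.val ≃o Nbhd P' (σ x).val)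

/-- The equal card ratio `ECR(X, Y)`: the largest number `m` of pairwise distinct points
`x_1, …, x_m` of `X` and pairwise distinct points `y_1, …, y_m` of `Y` with
`X∖{x_i} ≅ Y∖{y_i}` for all `i`, divided by the number of elements of `X`. -/
noncomputable def ecr (X Y : FinPoset) : ℝ :=
  (sSup {m : ℕ | ∃ (f : Fin m ↪ ↥X) (g : Fin m ↪ ↥Y),
      ∀ i : Fin m, Nonempty (Card ↥X (f i) ≃o Card ↥Y (g i))} : ℕ) /
    (Fintype.card ↥X : ℕ)

lemma card_mem_upperBounds_commonCards (X Y : FinPoset) : Fintype.card X ∈ upperBounds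
    {m : ℕ | ∃ (f : Fin m ↪ ↥X) (g : Fin m ↪ ↥Y),
      ∀ i : Fin m, Nonempty (Card ↥X (f i) ≃o Card ↥Y (g i))} := by
  rintro m ⟨f, -, -⟩
  simpa using Fintype.card_le_of_embedding f

lemma ecr_le_one (X Y : FinPoset) : ecr X Y ≤ 1 :=
  div_le_one_of_le₀ (Nat.cast_le.2 (csSup_le' (card_mem_upperBounds_commonCards X Y)))
    (Nat.cast_nonneg _)

/-- The points of the twisted ladder of length `N`: two minimal points `bot e`, pairs
`c i false, c i true` for `i ≤ N + 1`, four points `v i b b'` over each two consecutive pairs,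
and points `u i` for `i ≤ N`. The order depends on the twist `t`. -/
inductive Ladder (N : ℕ) (t : Bool) : Type
  | bot (e : Bool)
  | c (i : Fin (N + 2)) (b : Bool)
  | v (i : Fin (N + 1)) (b b' : Bool)
  | u (i : Fin (N + 1))

namespace Ladder

variable {N : ℕ} {t t' : Bool}

/-- The index of the pair of points `c` that is split by `bot e`. -/
def pinned (N : ℕ) (e : Bool) : ℕ := if e then N + 1 else 0

/-- The strict order of the ladder. The point `bot e` determines which point of the pair
`pinned N e` is which, and `u i` determines the two diagonals of the `i`-th square; the twist
exchanges the diagonals of the square of index `0`. -/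
def Lt : Ladder N t → Ladder N t → Prop
  | bot e, c i b => i.val = pinned N e → b = false
  | bot _, v _ _ _ => True
  | bot _, u _ => True
  | c i b, v j b₁ b₂ => (i.val = j.val ∧ b = b₁) ∨ (i.val = j.val + 1 ∧ b = b₂)
  | c _ _, u _ => True
  | v j b₁ b₂, u i => (i.val = 0 ∨ j.val ≤ i.val) ∧
      (j.val = i.val → xor b₁ b₂ = (t && decide (j.val = 0)))
  | u i, u j => 0 < i.val ∧ i.val < j.val
  | _, _ => False

/-- The rank function of the ladder. -/
def rk : Ladder N t → ℕ
  | bot _ => 0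
  | c _ _ => 1
  | v _ _ _ => 2
  | u i => 3 + (i.val - 1)

lemma Lt.rk_lt {x y : Ladder N t} (h : Lt x y) : rk x < rk y := by
  cases x <;> cases y <;> simp only [Lt, rk] at h ⊢ <;> omega

lemma Lt.trans {x y z : Ladder N t} (h : Lt x y) (h' : Lt y z) : Lt x z := by
  cases x <;> cases y <;> cases z <;> simp only [Lt] at h h' ⊢ <;> try omega

instance : PartialOrder (Ladder N t) where
  le x y := x = y ∨ Lt x y
  lt := Lt
  le_refl _ := Or.inl rfl
  le_trans x y z := by
    rintro (rfl | h) (rfl | h')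
    exacts [Or.inl rfl, Or.inr h', Or.inr h, Or.inr (h.trans h')]
  le_antisymm x y := by
    rintro (rfl | h) (h' | h')
    exacts [rfl, rfl, h'.symm, absurd h.rk_lt h'.rk_lt.asymm]
  lt_iff_le_not_ge x y := by
    refine ⟨fun h => ⟨Or.inr h, ?_⟩, ?_⟩
    · rintro (rfl | h')
      exacts [h.rk_lt.ne rfl, h.rk_lt.asymm h'.rk_lt]
    · rintro ⟨rfl | h, h'⟩
      exacts [absurd (Or.inl rfl) h', h]

lemma lt_def {x y : Ladder N t} : x < y ↔ Lt x y := Iff.rfl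

lemma le_def {x y : Ladder N t} : x ≤ y ↔ x = y ∨ Lt x y := Iff.rfl

/-- The ladder as a sum type. -/
def equivSum (N : ℕ) (t : Bool) : Ladder N t ≃
    (Bool ⊕ Fin (N + 2) × Bool) ⊕ (Fin (N + 1) × Bool × Bool ⊕ Fin (N + 1)) where
  toFun
    | bot e => .inl (.inl e)
    | c i b => .inl (.inr (i, b))
    | v i b b' => .inr (.inl (i, b, b'))
    | u i => .inr (.inr i)
  invFun
    | .inl (.inl e) => bot e
    | .inl (.inr (i, b)) => c i b
    | .inr (.inl (i, b, b')) => v i b b'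
    | .inr (.inr i) => u i
  left_inv x := by cases x <;> rfl
  right_inv x := by rcases x with (_ | _) | (_ | _) <;> rfl

instance : Fintype (Ladder N t) := .ofEquiv _ (equivSum N t).symm

lemma card_eq : Fintype.card (Ladder N t) = 7 * N + 11 := by
  rw [Fintype.card_congr (equivSum N t)]
  simp only [Fintype.card_sum, Fintype.card_prod, Fintype.card_bool, Fintype.card_fin]
  ring

lemma exists_lt_rk_succ (x : Ladder N t) (hx : rk x ≠ 0) : ∃ y < x, rk y + 1 = rk x := by
  cases x with
  | bot e => simp [rk] at hx
  | c i b =>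
    refine ⟨bot (decide (i.val = 0)), ?_, rfl⟩
    simp only [lt_def, Lt, pinned, decide_eq_true_eq]
    split_ifs <;> omega
  | v i b b' => exact ⟨c i.castSucc b, by simp [lt_def, Lt], rfl⟩
  | u i =>
    by_cases hi : i.val ≤ 1
    · refine ⟨v 0 t false, ?_, by simp [rk]; omega⟩
      simp [lt_def, Lt]
    · refine ⟨u ⟨i.val - 1, by omega⟩, ?_, by simp only [rk]; omega⟩
      simp only [lt_def, Lt]
      omega

lemma rk_strictMono : StrictMono (rk : Ladder N t → ℕ) := fun _ _ h => Lt.rk_lt h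

lemma height_eq (x : Ladder N t) : Order.height x = rk x := by
  refine le_antisymm ((Order.height_le_height_apply_of_strictMono _ rk_strictMono x).trans
    (Order.height_nat _).le) ?_
  induction h : rk x generalizing x with
  | zero => simp
  | succ n ih =>
    obtain ⟨y, hyx, hy⟩ := exists_lt_rk_succ x (by omega)
    push_cast
    exact (add_le_add_left (ih y (by omega)) 1).trans (Order.height_add_one_le hyx)

lemma height_eq_iff {x : Ladder N t} {k : ℕ} : Order.height x = k ↔ rk x = k := by
  rw [height_eq, Nat.cast_inj]

lemma isMax_iff (hN : 1 ≤ N) {x : Ladder N t} :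
    IsMax x ↔ ∃ i, x = u i ∧ (i.val = 0 ∨ i.val = N) := by
  rw [isMax_iff_forall_not_lt]
  constructor
  · intro h
    cases x with
    | bot e => exact absurd trivial (h (u 0))
    | c i b => exact absurd trivial (h (u 0))
    | v i b b' =>
      by_cases hb : xor b b' = (t && decide (i.val = 0))
      · exact absurd ⟨Or.inr le_rfl, fun _ => hb⟩ (h (u i))
      · by_cases hi : i.val = 0
        · exact absurd ⟨Or.inr (by simp [hi]), fun h' => by simp [hi] at h'⟩
            (h (u ⟨1, by omega⟩))
        · exact absurd ⟨Or.inl rfl, fun h' => absurd h' hi⟩ (h (u 0))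
    | u i =>
      refine ⟨i, rfl, ?_⟩
      by_contra! hi
      have := h (u ⟨i.val + 1, by omega⟩)
      simp only [lt_def, Lt] at this
      omega
  · rintro ⟨i, rfl, hi⟩ y hy
    cases y <;> simp only [lt_def, Lt] at hy
    omega

lemma isMin_iff {x : Ladder N t} : IsMin x ↔ ∃ e, x = bot e := by
  constructor
  · intro h
    cases x with
    | bot e => exact ⟨e, rfl⟩
    | c i b =>
      obtain ⟨y, hy, -⟩ := exists_lt_rk_succ (c i b : Ladder N t) one_ne_zero
      exact absurd hy h.not_lt
    | v i b b' =>
      obtain ⟨y, hy, -⟩ := exists_lt_rk_succ (v i b b' : Ladder N t) two_ne_zero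
      exact absurd hy h.not_lt
    | u i => exact absurd (show Lt (bot true) (u i) from trivial) h.not_lt
  · rintro ⟨e, rfl⟩
    rw [isMin_iff_forall_not_lt]
    intro y hy
    simpa [rk] using rk_strictMono hy

/-- Exchange the points of those pairs `c i` for which `γ i` holds, and carry along the
squares between them. -/
def flip (γ : ℕ → Bool) (t' : Bool) : Ladder N t → Ladder N t'
  | bot e => bot e
  | c i b => c i (xor b (γ i))
  | v i b b' => v i (xor b (γ i)) (xor b' (γ (i + 1)))
  | u i => u i

lemma flip_flip (γ : ℕ → Bool) (x : Ladder N t) : flip γ t (flip γ t' x) = x := by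
  cases x <;> simp [flip]

/-- `flip` as an equivalence. -/
def flipEquiv (γ : ℕ → Bool) (t t' : Bool) : Ladder N t ≃ Ladder N t' where
  toFun := flip γ t'
  invFun := flip γ t
  left_inv := flip_flip γ
  right_inv := flip_flip γ

@[simp] lemma rk_flip (γ : ℕ → Bool) (x : Ladder N t) : rk (flip γ t' x) = rk x := by
  cases x <;> rfl

/-- The map `flip γ` respects the order between `x` and `y`, with the two obstructions to that
excluded. -/
def Compat (γ : ℕ → Bool) (t' : Bool) : Ladder N t → Ladder N t → Prop
  | bot e, c i _ => i.val = pinned N e → γ i = false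
  | v j _ _, u i => j = i → xor (γ j) (γ (j + 1)) = (xor t t' && decide (j.val = 0))
  | _, _ => True

lemma Compat.flip_le_iff {γ : ℕ → Bool} {x y : Ladder N t} (h : Compat γ t' x y) :
    flip γ t' x ≤ flip γ t' y ↔ x ≤ y := by
  rw [le_def, le_def]
  refine or_congr (flipEquiv γ t t').injective.eq_iff ?_
  cases x <;> cases y <;> simp only [Lt, flip, Compat] at h ⊢
  case bot.c => grind
  case c.v =>
    refine or_congr (and_congr_right fun hi => ?_) (and_congr_right fun hi => ?_) <;>
      rw [hi, Bool.xor_left_inj]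
  case v.u j b b' i =>
    refine and_congr_right fun _ => forall_congr' fun hi => ?_
    have hγ := h (Fin.ext hi)
    generalize γ j.val = g, γ (j.val + 1) = g', decide (j.val = 0) = d at *
    clear h hi
    revert g g' d t t'
    decide +revert

/-- `flip γ` as an order isomorphism between subsets on which it respects the order. -/
def flipIso (γ : ℕ → Bool) (S : Ladder N t → Prop) (S' : Ladder N t' → Prop)
    (hS : ∀ x, S x ↔ S' (flip γ t' x)) (h : ∀ x y, S x → S y → Compat γ t' x y) :
    {x // S x} ≃o {y // S' y} where
  toEquiv := (flipEquiv γ t t').subtypeEquiv hS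
  map_rel_iff' {x y} := (h x y x.2 y.2).flip_le_iff

/-- The pairs to be exchanged in the neighborhood of a point in order to undo the twist. -/
def nbhdFlips : Ladder N t → ℕ → Bool
  | bot e, k => if e then k = 0 else 1 ≤ k
  | c i _, k => if i.val = 0 then k = 1 else k = 0
  | v i _ _, k => i.val = 0 ∧ k = 1
  | u i, k => i.val = 0 ∧ k = 1

/-- The correspondence between the points of ladders with different twist which
preserves neighborhoods. -/
def partner (t t' : Bool) : Ladder N t ≃ Ladder N t' where
  toFun
    | bot e => bot e
    | c i b => c i b
    | v i b b' => v i b (xor b' (i.val = 0))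
    | u i => u i
  invFun
    | bot e => bot e
    | c i b => c i b
    | v i b b' => v i b (xor b' (i.val = 0))
    | u i => u i
  left_inv x := by cases x <;> simp
  right_inv x := by cases x <;> simp

@[simp] lemma rk_partner (x : Ladder N t) : rk (partner t t' x) = rk x := by
  cases x <;> rfl

lemma flip_nbhdFlips (z : Ladder N t) : flip (nbhdFlips z) t' z = partner t t' z := by
  cases z with
  | bot e | u i => rfl
  | c i b | v i b b' => by_cases hi : i = 0 <;> simp [flip, nbhdFlips, partner, hi]

lemma compat_nbhdFlips (hN : 1 ≤ N) (htt : t' = !t) {x y z : Ladder N t}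
    (hx : x ≤ z ∨ z ≤ x) (hy : y ≤ z ∨ z ≤ y) : Compat (nbhdFlips z) t' x y := by
  subst htt
  cases x <;> cases y <;> try trivial
  · cases z <;> simp [le_def, Lt, Compat, nbhdFlips, pinned] at hx hy ⊢ <;> grind
  · cases z <;> simp [le_def, Lt, Compat, nbhdFlips] at hx hy ⊢ <;> grind

lemma compat_nbhdFlips_left (htt : t' = !t) (x z : Ladder N t) :
    Compat (nbhdFlips z) t' x z := by
  subst htt
  cases x <;> cases z <;> try trivial
  all_goals simp [Compat, nbhdFlips, pinned]
  all_goals grind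

lemma compat_nbhdFlips_right (htt : t' = !t) (x z : Ladder N t) :
    Compat (nbhdFlips z) t' z x := by
  subst htt
  cases x <;> cases z <;> try trivial
  all_goals simp [Compat, nbhdFlips, pinned]
  all_goals grind

lemma nonempty_nbhd_iso (hN : 1 ≤ N) (htt : t' = !t) (z : Ladder N t) :
    Nonempty (Nbhd (Ladder N t) z ≃o Nbhd (Ladder N t') (partner t t' z)) := by
  refine ⟨flipIso (nbhdFlips z) _ _ (fun x => ?_) fun x y => compat_nbhdFlips hN htt⟩
  rw [← flip_nbhdFlips, (compat_nbhdFlips_left htt x z).flip_le_iff,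
    (compat_nbhdFlips_right htt x z).flip_le_iff]

/-- The pairs to be exchanged in a card in order to undo the twist. -/
def cardFlips : Ladder N t → ℕ → Bool
  | bot e, k => if e then 1 ≤ k else k = 0
  | u i, k => 1 ≤ k ∧ k ≤ i.val
  | _, _ => false

/-- The points whose removal makes it possible to undo the twist. -/
def Removable : Ladder N t → Prop
  | bot _ | u _ => True
  | _ => False

lemma Removable.flip_eq {z : Ladder N t} (hz : Removable z) (γ : ℕ → Bool) :
    flip γ t' z = partner t t' z := by
  cases z <;> simp [Removable, flip, partner] at hz ⊢

lemma Removable.compat (htt : t' = !t) {x y z : Ladder N t} (hz : Removable z)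
    (hx : x ≠ z) (hy : y ≠ z) : Compat (cardFlips z) t' x y := by
  subst htt
  cases x <;> cases y <;> try trivial
  · cases z <;> simp [Removable, Compat, cardFlips, pinned] at hz hx hy ⊢ <;> grind
  · cases z <;> simp [Removable, Compat, cardFlips] at hz hx hy ⊢ <;> grind

/-- The isomorphism between the cards of corresponding removable points. -/
def Removable.cardIso (htt : t' = !t) {z : Ladder N t} (hz : Removable z) :
    Card (Ladder N t) z ≃o Card (Ladder N t') (partner t t' z) :=
  flipIso (cardFlips z) _ _
    (fun x => by rw [← hz.flip_eq (cardFlips z)]; exact (flipEquiv _ t t').injective.ne_iff.symm)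
    fun _ _ => hz.compat htt

lemma Removable.rk_cardIso (htt : t' = !t) {z : Ladder N t} (hz : Removable z)
    (x : Card (Ladder N t) z) : rk (hz.cardIso htt x).val = rk x.val :=
  rk_flip _ _

lemma equalMarkedMaxDecks (hN : 1 ≤ N) (htt : t' = !t) :
    EqualMarkedMaxDecksWithNbhds (Ladder N t) (Ladder N t') := by
  have h (x : Ladder N t) : IsMax x ↔ IsMax (partner t t' x) := by
    rw [isMax_iff hN, isMax_iff hN]
    cases x <;> simp [partner]
  refine ⟨(partner t t').subtypeEquiv h, fun ⟨m, hm⟩ => ⟨?_, nonempty_nbhd_iso hN htt m⟩⟩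
  obtain ⟨i, rfl, -⟩ := (isMax_iff hN).1 hm
  refine ⟨Removable.cardIso (z := u i) htt trivial, fun z hz => ?_⟩
  obtain ⟨j, hj, hj'⟩ := (isMax_iff hN).1 hz
  exact (isMax_iff hN).2 ⟨j, congrArg (flip _ t') hj, hj'⟩

lemma equalMarkedMinDecks (hN : 1 ≤ N) (htt : t' = !t) :
    EqualMarkedMinDecksWithNbhds (Ladder N t) (Ladder N t') := by
  have h (x : Ladder N t) : IsMin x ↔ IsMin (partner t t' x) := by
    rw [isMin_iff, isMin_iff]
    cases x <;> simp [partner]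
  refine ⟨(partner t t').subtypeEquiv h, fun ⟨m, hm⟩ => ⟨?_, nonempty_nbhd_iso hN htt m⟩⟩
  obtain ⟨e, rfl⟩ := isMin_iff.1 hm
  refine ⟨Removable.cardIso (z := bot e) htt trivial, fun z hz => ?_⟩
  obtain ⟨e', he'⟩ := isMin_iff.1 hz
  exact isMin_iff.2 ⟨e', congrArg (flip _ t') he'⟩

/-- The bijection between the points of rank `k` of ladders with different twist. -/
def rankEquiv (N : ℕ) (t t' : Bool) (k : ℕ) : {x : Ladder N t // Order.height x = (k : ℕ∞)} ≃
    {y : Ladder N t' // Order.height y = (k : ℕ∞)} :=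
  (partner t t').subtypeEquiv fun x => by rw [height_eq_iff, height_eq_iff, rk_partner]

lemma equalRankNbhdDecks (hN : 1 ≤ N) (htt : t' = !t) (k : ℕ) :
    EqualRankNbhdDecks (Ladder N t) (Ladder N t') k :=
  ⟨rankEquiv N t t' k, fun x => nonempty_nbhd_iso hN htt x⟩

lemma removable_of_three_le_rk {x : Ladder N t} (hx : 3 ≤ rk x) : Removable x := by
  cases x <;> simp [rk, Removable] at hx ⊢

lemma equalMarkedRankDecks (hN : 1 ≤ N) (htt : t' = !t) {k : ℕ} (hk : 3 ≤ k) :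
    EqualMarkedRankDecksWithNbhds (Ladder N t) (Ladder N t') k := by
  refine ⟨rankEquiv N t t' k, fun ⟨x, hx⟩ => ⟨?_, nonempty_nbhd_iso hN htt x⟩⟩
  have hr : Removable x := removable_of_three_le_rk (height_eq_iff.1 hx ▸ hk)
  exact ⟨hr.cardIso htt, fun z => by
    rw [height_eq, height_eq]; exact congrArg _ (hr.rk_cardIso htt z)⟩

lemma Removable.exists_card_iso (htt : t' = !t) {x : Ladder N t} (hx : Removable x) :
    ∃ y : Ladder N t', Order.height y = Order.height x ∧
      Nonempty (Card (Ladder N t) x ≃o Card (Ladder N t') y) :=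
  ⟨partner t t' x, by rw [height_eq, height_eq, rk_partner], ⟨hx.cardIso htt⟩⟩

lemma ncard_ranks_without_card_iso_le (htt : t' = !t) :
    {r : ℕ | (∃ x : Ladder N t, Order.height x = (r : ℕ∞)) ∧
      ¬ ∃ (x : Ladder N t) (y : Ladder N t'), Order.height x = (r : ℕ∞) ∧
        Order.height y = (r : ℕ∞) ∧
        Nonempty (Card (Ladder N t) x ≃o Card (Ladder N t') y)}.ncard ≤ 4 := by
  refine (Set.ncard_le_ncard (t := {1, 2}) ?_).trans ((Set.ncard_pair (by simp)).trans_le (by simp))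
  rintro r ⟨⟨x, hx⟩, h⟩
  have hr : ¬ Removable x := fun hr => by
    obtain ⟨y, hy, hc⟩ := hr.exists_card_iso htt
    exact h ⟨x, y, hx, hy.trans hx, hc⟩
  rw [height_eq_iff] at hx
  subst hx
  cases x <;> simp [Removable, rk] at hr ⊢

/-- The removable points of a ladder. -/
def removablePoint (N : ℕ) (t : Bool) : Bool ⊕ Fin (N + 1) ↪ Ladder N t where
  toFun := Sum.elim bot u
  inj' x y h := by cases x <;> cases y <;> simp_all

lemma one_tenth_le_ecr (htt : t' = !t) :
    (1 / 10 : ℝ) ≤ ecr ⟨Ladder N t⟩ ⟨Ladder N t'⟩ := by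
  have hmem : N + 3 ≤ _ :=
      le_csSup ⟨_, card_mem_upperBounds_commonCards ⟨Ladder N t⟩ ⟨Ladder N t'⟩⟩ <| by
    have e : Fin (N + 3) ≃ Bool ⊕ Fin (N + 1) := Fintype.equivOfCardEq (by simp; ring)
    refine ⟨e.toEmbedding.trans (removablePoint N t),
      (e.toEmbedding.trans (removablePoint N t)).trans (partner t t').toEmbedding, fun i => ?_⟩
    have hr : Removable (removablePoint N t (e i)) := by
      cases e i <;> trivial
    exact ⟨hr.cardIso htt⟩
  have hcard : Fintype.card (⟨Ladder N t⟩ : FinPoset) = 7 * N + 11 := card_eq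
  rw [ecr, hcard, div_le_div_iff₀ (by norm_num) (by positivity)]
  have := (Nat.cast_le (α := ℝ)).2 hmem
  push_cast at this ⊢
  linarith [(Nat.cast_nonneg N : (0 : ℝ) ≤ N)]

lemma rk_map (Φ : Ladder N t ≃o Ladder N t') (x : Ladder N t) : rk (Φ x) = rk x := by
  have h := Order.height_orderIso Φ x
  rwa [height_eq, height_eq, Nat.cast_inj] at h

lemma exists_map_bot (Φ : Ladder N t ≃o Ladder N t') (e : Bool) : ∃ e', Φ (bot e) = bot e' := by
  have h := rk_map Φ (bot e)
  cases hx : Φ (bot e) <;> simp [hx, rk] at h ⊢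

lemma exists_map_c (Φ : Ladder N t ≃o Ladder N t') (i : Fin (N + 2)) (b : Bool) :
    ∃ j b', Φ (c i b) = c j b' := by
  have h := rk_map Φ (c i b)
  cases hx : Φ (c i b) <;> simp [hx, rk] at h ⊢
  omega

lemma exists_map_v (Φ : Ladder N t ≃o Ladder N t') (i : Fin (N + 1)) (b b' : Bool) :
    ∃ j d d', Φ (v i b b') = v j d d' := by
  have h := rk_map Φ (v i b b')
  cases hx : Φ (v i b b') <;> simp [hx, rk] at h ⊢
  omega

lemma exists_map_u (Φ : Ladder N t ≃o Ladder N t') (i : Fin (N + 1)) :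
    ∃ j : Fin (N + 1), Φ (u i) = u j ∧ j.val - 1 = i.val - 1 := by
  have h := rk_map Φ (u i)
  cases hx : Φ (u i) <;> simp [hx, rk] at h ⊢ <;> omega

lemma map_u (hN : 2 ≤ N) (Φ : Ladder N t ≃o Ladder N t') (i : Fin (N + 1)) : Φ (u i) = u i := by
  have hpos (k : Fin (N + 1)) (hk : 0 < k.val) : Φ (u k) = u k := by
    obtain ⟨j, hj, hjk⟩ := exists_map_u Φ k
    rw [hj, u.injEq, Fin.ext_iff]
    by_cases hk' : 2 ≤ k.val
    · omega
    · obtain ⟨l, hl, -⟩ := exists_map_u Φ ⟨2, by omega⟩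
      have h : (u k : Ladder N t) < u ⟨2, by omega⟩ := by
        simp only [lt_def, Lt]; omega
      rw [← Φ.lt_iff_lt, hj, hl] at h
      simp only [lt_def, Lt] at h
      omega
  obtain hi | hi := Nat.eq_zero_or_pos i.val
  · obtain ⟨j, hj, hji⟩ := exists_map_u Φ i
    obtain hj' | hj' := Nat.eq_zero_or_pos j.val
    · rw [hj, u.injEq, Fin.ext_iff, hi, hj']
    · rw [← hpos j hj', Φ.injective.eq_iff, u.injEq] at hj
      omega
  · exact hpos i hi

/-- The pairs an isomorphism of ladders has to exchange: if the twists differ, all but the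
first one. -/
def isoFlips (t t' : Bool) (k : ℕ) : Bool := xor t t' && decide (k ≠ 0)

lemma map_bot_false_and_map_c_zero_true (hN : 2 ≤ N) (Φ : Ladder N t ≃o Ladder N t') :
    Φ (bot false) = bot false ∧ Φ (c 0 true) = c 0 true := by
  obtain ⟨e, he⟩ := exists_map_bot Φ false
  obtain ⟨i, b, hc⟩ := exists_map_c Φ 0 true
  obtain ⟨j, d, d', hv⟩ := exists_map_v Φ 0 true t
  have h₁ : ¬ (bot false : Ladder N t) < c 0 true := by simp [lt_def, Lt, pinned]
  have h₂ : ¬ (v 0 true t : Ladder N t) < u 0 := by simp [lt_def, Lt]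
  have h₃ : (c 0 true : Ladder N t) < v 0 true t := by simp [lt_def, Lt]
  rw [← Φ.lt_iff_lt, he, hc] at h₁
  rw [← Φ.lt_iff_lt, hv, map_u hN] at h₂
  rw [← Φ.lt_iff_lt, hc, hv] at h₃
  simp only [lt_def, Lt] at h₁ h₂ h₃
  have hj : j.val = 0 := by
    by_contra hj
    exact h₂ ⟨Or.inl rfl, fun h => absurd h hj⟩
  have hi : i.val = pinned N e := by
    by_contra hi
    exact h₁ fun h => absurd h hi
  have hb : b = true := by simpa [hi] using h₁
  cases e with
  | false => exact ⟨he, by rw [hc, hb, c.injEq, Fin.ext_iff]; exact ⟨hi, rfl⟩⟩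
  | true =>
    simp only [pinned, if_true] at hi
    omega

lemma map_bot (hN : 2 ≤ N) (Φ : Ladder N t ≃o Ladder N t') (e : Bool) : Φ (bot e) = bot e := by
  have hf := (map_bot_false_and_map_c_zero_true hN Φ).1
  cases e with
  | false => exact hf
  | true =>
    obtain ⟨e', he'⟩ := exists_map_bot Φ true
    cases e' with
    | true => exact he'
    | false => simp [← hf] at he'

lemma map_c_zero (hN : 2 ≤ N) (Φ : Ladder N t ≃o Ladder N t') (b : Bool) :
    Φ (c 0 b) = c 0 b := by
  have ht := (map_bot_false_and_map_c_zero_true hN Φ).2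
  cases b with
  | true => exact ht
  | false =>
    obtain ⟨i, b, hc⟩ := exists_map_c Φ 0 false
    obtain ⟨j, d, d', hv⟩ := exists_map_v Φ 0 false (!t)
    have h₁ : (c 0 false : Ladder N t) < v 0 false (!t) := by simp [lt_def, Lt]
    have h₂ : ¬ (v 0 false (!t) : Ladder N t) < u 0 := by simp [lt_def, Lt]
    rw [← Φ.lt_iff_lt, hc, hv] at h₁
    rw [← Φ.lt_iff_lt, hv, map_u hN] at h₂
    simp only [lt_def, Lt] at h₁ h₂
    have hj : j.val = 0 := by
      by_contra hj
      exact h₂ ⟨Or.inl rfl, fun h => absurd h hj⟩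
    obtain hi | hi : i.val = 0 ∨ i.val = 1 := by omega
    · obtain rfl : i = 0 := Fin.ext hi
      cases b with
      | false => exact hc
      | true => simp [← ht] at hc
    · obtain ⟨m, x, y, hm⟩ := exists_map_v Φ.symm 0 true b
      have h₃ : Φ (c 0 true) < v 0 true b := by rw [ht]; simp [lt_def, Lt]
      have h₄ : Φ (c 0 false) < v 0 true b := by rw [hc]; simp [lt_def, Lt, hi]
      rw [← OrderIso.lt_symm_apply, hm] at h₃ h₄
      simp only [lt_def, Lt, Fin.val_zero] at h₃ h₄
      obtain ⟨-, rfl⟩ | ⟨h, -⟩ := h₃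
      · simp at h₄
      · omega

lemma map_v_of_map_c (hN : 2 ≤ N) (Φ : Ladder N t ≃o Ladder N t') (k : Fin (N + 1))
    (hc : ∀ b, Φ (c k.castSucc b) = c k.castSucc (xor b (isoFlips t t' k)))
    (hprev : ∀ j : Fin (N + 1), j.val + 1 = k.val → ∀ b b',
      Φ (v j b b') = v j (xor b (isoFlips t t' j)) (xor b' (isoFlips t t' (j + 1))))
    (b b' : Bool) :
    Φ (v k b b') = v k (xor b (isoFlips t t' k)) (xor b' (isoFlips t t' (k + 1))) := by
  obtain ⟨j, d, d', hv⟩ := exists_map_v Φ k b b'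
  have h₁ : (c k.castSucc b : Ladder N t) < v k b b' := by simp [lt_def, Lt]
  have h₂ : (v k b b' : Ladder N t) < u k ↔ xor b b' = (t && decide (k.val = 0)) := by
    simp [lt_def, Lt]
  rw [← Φ.lt_iff_lt, hv, hc] at h₁
  rw [← Φ.lt_iff_lt, hv, map_u hN] at h₂
  obtain ⟨hj, hd⟩ | ⟨hj, hd⟩ := h₁
  · obtain rfl : k = j := Fin.ext hj
    simp only [lt_def, Lt, le_refl, or_true, true_and, forall_const] at h₂
    rw [hv, v.injEq]
    refine ⟨rfl, hd.symm, ?_⟩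
    subst hd
    clear hv hprev hc
    by_cases hk : k.val = 0 <;> simp [isoFlips, hk] at h₂ ⊢ <;>
      cases t <;> cases t' <;> cases b <;> cases b' <;> cases d' <;> simp_all
  · have h := hprev j hj.symm (xor d (isoFlips t t' j)) (xor d' (isoFlips t t' (j + 1)))
    rw [Bool.xor_assoc, Bool.xor_assoc, Bool.xor_self, Bool.xor_self, Bool.xor_false,
      Bool.xor_false, ← hv, Φ.injective.eq_iff, v.injEq, Fin.ext_iff] at h
    simp only [Fin.val_castSucc] at hj
    omega

lemma map_c_succ_of_map_v (Φ : Ladder N t ≃o Ladder N t') (k : Fin (N + 1))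
    (hc : ∀ b, Φ (c k.castSucc b) = c k.castSucc (xor b (isoFlips t t' k)))
    (hv : ∀ b b', Φ (v k b b') =
      v k (xor b (isoFlips t t' k)) (xor b' (isoFlips t t' (k + 1)))) (b : Bool) :
    Φ (c k.succ b) = c k.succ (xor b (isoFlips t t' (k + 1))) := by
  obtain ⟨i, d, hi⟩ := exists_map_c Φ k.succ b
  have h : (c k.succ b : Ladder N t) < v k false b := by simp [lt_def, Lt]
  rw [← Φ.lt_iff_lt, hv, hi] at h
  obtain ⟨hk, hd⟩ | ⟨hk, hd⟩ := h
  · obtain rfl : i = k.castSucc := Fin.ext hk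
    have h' : Φ (c k.succ b) = Φ (c k.castSucc false) := by rw [hc, hi, hd]
    rw [Φ.injective.eq_iff, c.injEq, Fin.ext_iff] at h'
    simp at h'
  · rw [hi, c.injEq, Fin.ext_iff]
    exact ⟨hk, hd⟩

lemma map_c_and_map_v (hN : 2 ≤ N) (Φ : Ladder N t ≃o Ladder N t') (k : Fin (N + 1)) :
    (∀ b, Φ (c k.castSucc b) = c k.castSucc (xor b (isoFlips t t' k))) ∧
      ∀ b b', Φ (v k b b') =
        v k (xor b (isoFlips t t' k)) (xor b' (isoFlips t t' (k + 1))) := by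
  obtain ⟨n, hn⟩ := k
  induction n with
  | zero =>
    have hc (b) : Φ (c (Fin.castSucc ⟨0, hn⟩) b) =
        c (Fin.castSucc ⟨0, hn⟩) (xor b (isoFlips t t' 0)) := by
      simpa [isoFlips] using map_c_zero hN Φ b
    exact ⟨hc, map_v_of_map_c hN Φ _ hc (by simp)⟩
  | succ n ih =>
    obtain ⟨hc, hv⟩ := ih (by omega)
    have hc' := map_c_succ_of_map_v Φ _ hc hv
    refine ⟨hc', map_v_of_map_c hN Φ _ hc' fun j hj => ?_⟩
    obtain rfl : j = ⟨n, Nat.lt_of_succ_lt hn⟩ := Fin.ext (by simpa using hj)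
    exact hv

lemma isEmpty_orderIso (hN : 2 ≤ N) (htt : t' = !t) : IsEmpty (Ladder N t ≃o Ladder N t') := by
  refine ⟨fun Φ => ?_⟩
  obtain ⟨hc, hv⟩ := map_c_and_map_v hN Φ (Fin.last N)
  have h : ¬ (bot true : Ladder N t) < c (Fin.last N).succ true := by simp [lt_def, Lt, pinned]
  rw [← Φ.lt_iff_lt, map_bot hN, map_c_succ_of_map_v Φ _ hc hv] at h
  simp [lt_def, Lt, isoFlips, htt] at h

end Ladder

/--
There is a sequence of pairs `(P1 n, P2 n)` (for `n ≥ 1`) of finite ordered sets such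
that: (1) `P1 n` is not order-isomorphic to `P2 n`; (2) they have equal marked maximal
and minimal decks; (3) there are `n + 1` distinct ranks `k_0, …, k_n` with equal marked
rank `k_i` decks; (4) in all the deck equalities of (2) and (3) the neighborhoods of the
corresponding removed elements are isomorphic; (5) there are at most four ranks that do
not produce any pair of isomorphic cards; (6) `liminf_{n→∞} ECR(P1 n, P2 n) ≥ 1/10`;
and (7) for every rank `k` the rank-`k` neighborhood decks are equal.
-/
theorem exists_tall_pairs :
    ∃ P1 P2 : ℕ → FinPoset,
      (∀ n : ℕ, 1 ≤ n →
        IsEmpty (↥(P1 n) ≃o ↥(P2 n)) ∧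
        EqualMarkedMaxDecksWithNbhds ↥(P1 n) ↥(P2 n) ∧
        EqualMarkedMinDecksWithNbhds ↥(P1 n) ↥(P2 n) ∧
        (∃ k : Fin (n + 1) → ℕ, Function.Injective k ∧
          ∀ i : Fin (n + 1), EqualMarkedRankDecksWithNbhds ↥(P1 n) ↥(P2 n) (k i)) ∧
        ({r : ℕ | (∃ x : ↥(P1 n), Order.height x = (r : ℕ∞)) ∧
            ¬ ∃ (x : ↥(P1 n)) (y : ↥(P2 n)), Order.height x = (r : ℕ∞) ∧
              Order.height y = (r : ℕ∞) ∧
              Nonempty (Card ↥(P1 n) x ≃o Card ↥(P2 n) y)}.ncard ≤ 4) ∧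
        (∀ k : ℕ, EqualRankNbhdDecks ↥(P1 n) ↥(P2 n) k)) ∧
      (1 / 10 : ℝ) ≤ Filter.liminf (fun n => ecr (P1 n) (P2 n)) Filter.atTop := by
  refine ⟨fun n => ⟨Ladder (n + 2) false⟩, fun n => ⟨Ladder (n + 2) true⟩, fun n _ =>
    ⟨Ladder.isEmpty_orderIso (by omega) rfl, Ladder.equalMarkedMaxDecks (by omega) rfl,
      Ladder.equalMarkedMinDecks (by omega) rfl, ⟨fun i => 3 + i, fun i j h => ?_, fun i =>
        Ladder.equalMarkedRankDecks (by omega) rfl (Nat.le_add_right _ _)⟩,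
      Ladder.ncard_ranks_without_card_iso_le rfl,
      Ladder.equalRankNbhdDecks (by omega) rfl⟩, ?_⟩
  · simpa [Fin.ext_iff] using h
  · exact Filter.le_liminf_of_le (Filter.isCoboundedUnder_ge_of_le _ fun n => ecr_le_one _ _)
      (.of_forall fun n => Ladder.one_tenth_le_ecr rfl)
end

section
/- Under the folding hypotheses described in the context, for all points p∈P and p'∈P' such that there is an order isomorphism from P∖{p} onto P'∖{p'} mapping A∖{p} onto A'∖{p'}, S∖{p} onto S'∖{p'}, and F∖{p} onto F'∖{p'}, the card P_{F,S}∖{p} is order-isomorphic to the card P'_{F',S'}∖{p'}. -/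
/-- `Cross A x y`: the comparability `x < y` "crosses" the antichain `A`, i.e. there are
`a, b ∈ A` with `x < a` and `b < y`.  These are the comparabilities that get erased. -/
def Cross {P : Type*} [PartialOrder P] (A : Set P) (x y : P) : Prop :=
  ∃ a ∈ A, ∃ b ∈ A, x < a ∧ b < y

/-- One step in the comparability graph of the `A`-separation of `P`: a non-erased
comparability between two distinct points outside `A`. -/
def SepStep {P : Type*} [PartialOrder P] (A : Set P) (u v : P) : Prop :=
  u ∉ A ∧ v ∉ A ∧ u ≠ v ∧ ((u < v ∧ ¬ Cross A u v) ∨ (v < u ∧ ¬ Cross A v u))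

/-- Reachability (connectedness) in the `A`-separation of `P`. -/
def SepReach {P : Type*} [PartialOrder P] (A : Set P) : P → P → Prop :=
  Relation.ReflTransGen (SepStep A)

/-- An antichain `A ⊆ P` is a seam iff removing all crossing comparabilities and the
points of `A` disconnects `P`. -/
def IsSeam {P : Type*} [PartialOrder P] (A : Set P) : Prop :=
  IsAntichain (· ≤ ·) A ∧ ∃ x y : P, x ∉ A ∧ y ∉ A ∧ ¬ SepReach A x y

/-- A foldable seam. -/
def FoldableSeam {P : Type*} [PartialOrder P] (A : Set P) : Prop :=
  IsSeam A ∧ ∀ x y : P, x < y → Cross A x y → ∃ c ∈ A, x < c ∧ c < y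

/-- A breakable seam. -/
def BreakableSeam {P : Type*} [PartialOrder P] (A : Set P) : Prop :=
  IsSeam A ∧ ∀ x y : P, Cross A x y → x < y

/-- `F` is a union of connected components of the `A`-separation of `P`. -/
def UnionOfComponents {P : Type*} [PartialOrder P] (A F : Set P) : Prop :=
  F ⊆ Aᶜ ∧ ∀ x ∈ F, ∀ y, SepReach A x y → y ∈ F

/-- The order relation of the fold `P_{F,S}`: all crossing comparabilities are erased,
the remaining comparabilities within `S ∪ A` are kept, and the remaining
comparabilities within `F ∪ A` are reversed. -/
def FoldLE {P : Type*} [PartialOrder P] (A F S : Set P) (x y : P) : Prop :=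
  x = y ∨
    (x ∈ S ∪ A ∧ y ∈ S ∪ A ∧ x < y ∧ ¬ Cross A x y) ∨
    (x ∈ F ∪ A ∧ y ∈ F ∪ A ∧ y < x ∧ ¬ Cross A y x)

/-- A finite ordered set is connected iff its comparability graph is connected. -/
def ConnectedPoset (P : Type*) [PartialOrder P] : Prop :=
  Nonempty P ∧
    ∀ x y : P, Relation.ReflTransGen (fun u v => u ≠ v ∧ (u ≤ v ∨ v ≤ u)) x y

/-- The set of elements of `P` of rank `k` (rank is `Order.height`). -/
def rankSet (P : Type*) [PartialOrder P] (k : ℕ) : Set P :=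
  {x : P | Order.height x = (k : ℕ∞)}

/-- One step in the comparability graph of the induced subposet on `T`. -/
def StepIn {P : Type*} [PartialOrder P] (T : Set P) (u v : P) : Prop :=
  u ∈ T ∧ v ∈ T ∧ u ≠ v ∧ (u ≤ v ∨ v ≤ u)

/-- Reachability in the comparability graph of the induced subposet on `T`. -/
def ReachIn {P : Type*} [PartialOrder P] (T : Set P) : P → P → Prop :=
  Relation.ReflTransGen (StepIn T)

/-- The connected component of the point `x` in the induced subposet on `T`. -/
def CompIn {P : Type*} [PartialOrder P] (T : Set P) (x : P) : Set P :=
  {y | y ∈ T ∧ ReachIn T x y}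

/-- The folding hypotheses for the pair `(P, F, S)`, `(P', F', S')` at rank `k`
(the seams being `A = rankSet P k` and `A' = rankSet P' k`). -/
structure FoldHyps (P P' : Type*) [PartialOrder P] [Fintype P] [PartialOrder P'] [Fintype P']
    (k : ℕ) (F S : Set P) (F' S' : Set P') : Prop where
  conn : ConnectedPoset P
  conn' : ConnectedPoset P'
  /-- `A` and `A'` are both foldable seams or both breakable seams -/
  seams : (FoldableSeam (rankSet P k) ∧ FoldableSeam (rankSet P' k)) ∨
    (BreakableSeam (rankSet P k) ∧ BreakableSeam (rankSet P' k))
  hF : UnionOfComponents (rankSet P k) F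
  hS : UnionOfComponents (rankSet P k) S
  hFne : F.Nonempty
  hSne : S.Nonempty
  hdisj : Disjoint F S
  hcover : F ∪ S = (rankSet P k)ᶜ
  /-- `F` contains no points below any element of `A` -/
  hF_not_below : ∀ x ∈ F, ∀ a ∈ rankSet P k, ¬ x < a
  /-- `S` contains no points above any element of `A` -/
  hS_not_above : ∀ x ∈ S, ∀ a ∈ rankSet P k, ¬ a < x
  /-- no element of `S` is above any element of `F` -/
  hSF : ∀ f ∈ F, ∀ s ∈ S, ¬ f < s
  hF' : UnionOfComponents (rankSet P' k) F'
  hS' : UnionOfComponents (rankSet P' k) S'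
  hFne' : F'.Nonempty
  hSne' : S'.Nonempty
  hdisj' : Disjoint F' S'
  hcover' : F' ∪ S' = (rankSet P' k)ᶜ
  hF_not_below' : ∀ x ∈ F', ∀ a ∈ rankSet P' k, ¬ x < a
  hS_not_above' : ∀ x ∈ S', ∀ a ∈ rankSet P' k, ¬ a < x
  hSF' : ∀ f ∈ F', ∀ s ∈ S', ¬ f < s
  /-- all elements of `P` of dual rank `≥ k` are in `S ∪ A` -/
  dual_rank : ∀ x : P, (k : ℕ∞) ≤ Order.coheight x → x ∈ S ∪ rankSet P k
  /-- all elements of `S` have rank less than `k` -/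
  rank_S : ∀ x ∈ S, Order.height x < (k : ℕ∞)
  dual_rank' : ∀ x : P', (k : ℕ∞) ≤ Order.coheight x → x ∈ S' ∪ rankSet P' k
  rank_S' : ∀ x ∈ S', Order.height x < (k : ℕ∞)
  /-- no component of `F ∪ A` is isomorphic to the dual of a component of `S' ∪ A'` -/
  no_dual_iso : ∀ x ∈ F ∪ rankSet P k, ∀ y ∈ S' ∪ rankSet P' k,
    IsEmpty (↥(CompIn (F ∪ rankSet P k) x) ≃o (↥(CompIn (S' ∪ rankSet P' k) y))ᵒᵈ)
  /-- no component of `F' ∪ A'` is isomorphic to the dual of a component of `S ∪ A` -/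
  no_dual_iso' : ∀ x ∈ F' ∪ rankSet P' k, ∀ y ∈ S ∪ rankSet P k,
    IsEmpty (↥(CompIn (F' ∪ rankSet P' k) x) ≃o (↥(CompIn (S ∪ rankSet P k) y))ᵒᵈ)

/-- Provided no point of `S` is above, and no point of `F` is below, a point of the antichain `A`,
no comparability inside `S ∪ A` or `F ∪ A` crosses `A`, so the fold order is the given order
on `S ∪ A` and its dual on `F ∪ A`. -/
theorem foldLE_iff_of_antichain {P : Type*} [PartialOrder P] {A F S : Set P}
    (hA : IsAntichain (· ≤ ·) A) (hF : ∀ x ∈ F, ∀ a ∈ A, ¬ x < a)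
    (hS : ∀ x ∈ S, ∀ a ∈ A, ¬ a < x) (x y : P) :
    FoldLE A F S x y ↔
      x = y ∨ (x ∈ S ∪ A ∧ y ∈ S ∪ A ∧ x < y) ∨ (x ∈ F ∪ A ∧ y ∈ F ∪ A ∧ y < x) := by
  have hlt : ∀ a ∈ A, ∀ b ∈ A, ¬ a < b := fun a ha b hb h => hA ha hb h.ne h.le
  have above : ∀ u v, v ∈ S ∪ A → ¬ Cross A u v := by
    rintro u v (hv | hv) ⟨_, _, b, hb, _, hbv⟩
    · exact hS v hv b hb hbv
    · exact hlt b hb v hv hbv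
  have below : ∀ u v, u ∈ F ∪ A → ¬ Cross A u v := by
    rintro u v (hu | hu) ⟨a, ha, _, _, hua, _⟩
    · exact hF u hu a ha hua
    · exact hlt u hu a ha hua
  have h₁ := above x y
  have h₂ := below y x
  unfold FoldLE
  tauto

/--
Under the folding hypotheses, for all points `p ∈ P` and `p' ∈ P'` such that there is
an order isomorphism `P∖{p} → P'∖{p'}` mapping `A∖{p}` onto `A'∖{p'}`, `S∖{p}` onto
`S'∖{p'}` and `F∖{p}` onto `F'∖{p'}`, the card `P_{F,S}∖{p}` of the fold is isomorphic
to the card `P'_{F',S'}∖{p'}` of the fold (as a bijection preserving and reflecting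
the fold orders).
-/
theorem fold_card_iso {P P' : Type*} [PartialOrder P] [Fintype P]
    [PartialOrder P'] [Fintype P'] {k : ℕ} {F S : Set P} {F' S' : Set P'}
    (H : FoldHyps P P' k F S F' S') (p : P) (p' : P')
    (hiso : ∃ Ψ : Card P p ≃o Card P' p', ∀ z : Card P p,
      (z.val ∈ rankSet P k ↔ (Ψ z).val ∈ rankSet P' k) ∧
      (z.val ∈ S ↔ (Ψ z).val ∈ S') ∧ (z.val ∈ F ↔ (Ψ z).val ∈ F')) :
    ∃ e : Card P p ≃ Card P' p', ∀ x y : Card P p,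
      FoldLE (rankSet P k) F S x.val y.val ↔
        FoldLE (rankSet P' k) F' S' (e x).val (e y).val := by
  have hA : IsAntichain (· ≤ ·) (rankSet P k) := H.seams.elim (·.1.1.1) (·.1.1.1)
  have hA' : IsAntichain (· ≤ ·) (rankSet P' k) := H.seams.elim (·.2.1.1) (·.2.1.1)
  obtain ⟨Ψ, hΨ⟩ := hiso
  refine ⟨Ψ.toEquiv, fun x y => ?_⟩
  have hlt : ∀ u v : Card P p, (Ψ u).val < (Ψ v).val ↔ u.val < v.val := fun u v => Ψ.lt_iff_lt
  have heq : (Ψ x).val = (Ψ y).val ↔ x.val = y.val := by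
    rw [Subtype.val_inj, Subtype.val_inj, Ψ.injective.eq_iff]
  rw [foldLE_iff_of_antichain hA H.hF_not_below H.hS_not_above,
    foldLE_iff_of_antichain hA' H.hF_not_below' H.hS_not_above']
  simp only [RelIso.coe_fn_toEquiv, Set.mem_union, hlt, heq, (hΨ _).1, (hΨ _).2.1, (hΨ _).2.2]
end

section
/- Let k≥0 and let P and Q be finite ordered sets with equal marked rank k decks. Suppose that: P and Q each have more than one element of rank k; in each of P and Q, no two distinct elements of rank k have both the same set of strict upper bounds and the same set of strict lower bounds; and the induced subposets P∖P_k and Q∖Q_k are rigid, where P_k and Q_k denote the sets of rank-k elements of P and Q respectively. Then P and Q are order-isomorphic. -/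
/-- `P` and `Q` have equal marked rank `k` decks: a bijection `σ` between the rank-`k`
elements such that each card `P∖{x}` is isomorphic to `Q∖{σ x}` via a rank-preserving
order isomorphism.  (The rank of an element is `Order.height`.) -/
def EqualMarkedRankDecks (P Q : Type*) [PartialOrder P] [PartialOrder Q] (k : ℕ) : Prop :=
  ∃ σ : {x : P // Order.height x = (k : ℕ∞)} ≃ {y : Q // Order.height y = (k : ℕ∞)},
    ∀ x : {x : P // Order.height x = (k : ℕ∞)},
      ∃ Φ : Card P x.val ≃o Card Q (σ x).val,
        ∀ z : Card P x.val, Order.height (Φ z).val = Order.height z.val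

section

variable {P Q : Type*} [PartialOrder P] [PartialOrder Q]

/-- `x` and `y` have the same strict bounds up to `ψ`. -/
def HaveMatchingBounds {s : P → Prop} {t : Q → Prop} (ψ : {p // ¬ s p} ≃o {q // ¬ t q})
    (x : P) (y : Q) : Prop :=
  ∀ r, (r.val < x ↔ (ψ r).val < y) ∧ (x < r.val ↔ y < (ψ r).val)

/-- Elements of an antichain `t` with strict bounds matching those of `x` share their bounds. -/
theorem HaveMatchingBounds.eq_right {s : P → Prop} {t : Q → Prop}
    {ψ : {p // ¬ s p} ≃o {q // ¬ t q}} {x : P} {y z : Q}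
    (ht : ∀ a b, t a → t b → ¬ a < b)
    (hsep : ∀ a b : Q, t a → t b → {c | a < c} = {c | b < c} → {c | c < a} = {c | c < b} → a = b)
    (hy : t y) (hz : t z) (hxy : HaveMatchingBounds ψ x y) (hxz : HaveMatchingBounds ψ x z) :
    y = z := by
  have key : ∀ c, (y < c ↔ z < c) ∧ (c < y ↔ c < z) := by
    intro c
    by_cases hc : t c
    · simp [ht _ _ hy hc, ht _ _ hz hc, ht _ _ hc hy, ht _ _ hc hz]
    · obtain ⟨r, hr⟩ := ψ.surjective ⟨c, hc⟩
      have h₁ := hxy r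
      have h₂ := hxz r
      rw [hr] at h₁ h₂
      exact ⟨h₁.2.symm.trans h₂.2, h₁.1.symm.trans h₂.1⟩
  exact hsep y z hy hz (Set.ext fun c => (key c).1) (Set.ext fun c => (key c).2)

theorem HaveMatchingBounds.symm {s : P → Prop} {t : Q → Prop}
    {ψ : {p // ¬ s p} ≃o {q // ¬ t q}} {x : P} {y : Q} (h : HaveMatchingBounds ψ x y) :
    HaveMatchingBounds ψ.symm y x := by
  intro r
  have := h (ψ.symm r)
  rw [ψ.apply_symm_apply] at this
  exact ⟨this.1.symm, this.2.symm⟩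

/-- An isomorphism between the complements of two antichains, each without distinct elements
having the same strict bounds, extends to the whole posets as soon as it matches the bounds. -/
theorem nonempty_orderIso_of_haveMatchingBounds {s : P → Prop} {t : Q → Prop}
    (ψ : {p // ¬ s p} ≃o {q // ¬ t q})
    (hs : ∀ a b, s a → s b → ¬ a < b) (ht : ∀ a b, t a → t b → ¬ a < b)
    (hssep : ∀ a b : P, s a → s b → {c | a < c} = {c | b < c} → {c | c < a} = {c | c < b} → a = b)
    (htsep : ∀ a b : Q, t a → t b → {c | a < c} = {c | b < c} → {c | c < a} = {c | c < b} → a = b)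
    (hst : ∀ x, s x → ∃ y, t y ∧ HaveMatchingBounds ψ x y)
    (hts : ∀ y, t y → ∃ x, s x ∧ HaveMatchingBounds ψ x y) :
    Nonempty (P ≃o Q) := by
  classical
  have hst' : ∀ x : {p // s p}, ∃ y : {q // t q}, HaveMatchingBounds ψ x.val y.val := fun x =>
    let ⟨y, hy, h⟩ := hst x x.2
    ⟨⟨y, hy⟩, h⟩
  choose g hg using hst'
  have hbij : Function.Bijective g := by
    refine ⟨fun a b hab => ?_, fun y => ?_⟩
    · exact Subtype.ext ((hg a).symm.eq_right hs hssep a.2 b.2 (hab ▸ (hg b).symm))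
    · obtain ⟨x, hx, h⟩ := hts y y.2
      exact ⟨⟨x, hx⟩, Subtype.ext ((hg ⟨x, hx⟩).eq_right ht htsep (g _).2 y.2 h)⟩
  let e : P ≃ Q := (Equiv.sumCompl s).symm.trans
    (((Equiv.ofBijective g hbij).sumCongr ψ.toEquiv).trans (Equiv.sumCompl t))
  have he₁ : ∀ (x : P) (hx : s x), e x = (g ⟨x, hx⟩).val := by
    intro x hx
    simp [e, Equiv.sumCompl_symm_apply_of_pos hx]
  have he₂ : ∀ (x : P) (hx : ¬ s x), e x = (ψ ⟨x, hx⟩).val := by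
    intro x hx
    simp [e, Equiv.sumCompl_symm_apply_of_neg hx]
  have hlt : ∀ a b, e a < e b ↔ a < b := by
    intro a b
    by_cases ha : s a <;> by_cases hb : s b
    · rw [he₁ a ha, he₁ b hb]
      exact iff_of_false (ht _ _ (g _).2 (g _).2) (hs _ _ ha hb)
    · rw [he₁ a ha, he₂ b hb]
      exact (hg ⟨a, ha⟩ ⟨b, hb⟩).2.symm
    · rw [he₂ a ha, he₁ b hb]
      exact (hg ⟨b, hb⟩ ⟨a, ha⟩).1.symm
    · rw [he₂ a ha, he₂ b hb]
      exact ψ.lt_iff_lt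
  refine ⟨⟨e, fun {a b} => ?_⟩⟩
  rw [le_iff_lt_or_eq, le_iff_lt_or_eq, hlt, e.injective.eq_iff]

/-- An isomorphism of cards carrying `s` to `t` restricts to the complements of `s` and `t`. -/
def cardIsoRestrict {s : P → Prop} {t : Q → Prop} {x : P} {y : Q} (hx : s x) (hy : t y)
    (Φ : Card P x ≃o Card Q y) (h : ∀ z, t (Φ z).val ↔ s z.val) :
    {p // ¬ s p} ≃o {q // ¬ t q} where
  toFun r := ⟨(Φ ⟨r.1, fun e => r.2 (e ▸ hx)⟩).val, fun hr => r.2 ((h _).1 hr)⟩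
  invFun r := ⟨(Φ.symm ⟨r.1, fun e => r.2 (e ▸ hy)⟩).val, fun hr => r.2 (by
    simpa using (h (Φ.symm ⟨r.1, fun e => r.2 (e ▸ hy)⟩)).2 hr)⟩
  left_inv r := by simp
  right_inv r := by simp
  map_rel_iff' {a b} := by
    change Φ _ ≤ Φ _ ↔ _
    rw [Φ.le_iff_le]
    rfl

theorem haveMatchingBounds_cardIsoRestrict {s : P → Prop} {t : Q → Prop} {x : P} {y : Q}
    (hx : s x) (hy : t y) (Φ : Card P x ≃o Card Q y) (h : ∀ z, t (Φ z).val ↔ s z.val)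
    (z : Card P x) :
    HaveMatchingBounds (cardIsoRestrict hx hy Φ h) z.val (Φ z).val := by
  intro r
  have hr : r.1 ≠ x := fun e => r.2 (e ▸ hx)
  exact ⟨(Φ.lt_iff_lt (x := ⟨r.1, hr⟩) (y := z)).symm,
    (Φ.lt_iff_lt (x := z) (y := ⟨r.1, hr⟩)).symm⟩

/-- Any two isomorphisms out of a rigid poset are equal. -/
theorem orderIso_eq_of_rigid (hrigid : ∀ f : P ≃o P, ∀ z, f z = z) (f g : P ≃o Q) : f = g := by
  ext z
  have := hrigid (f.trans g.symm) z
  rwa [OrderIso.trans_apply, OrderIso.symm_apply_eq] at this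

theorem not_lt_of_height_eq_coe {k : ℕ} {a b : P} (ha : Order.height a = (k : ℕ∞))
    (hb : Order.height b = (k : ℕ∞)) : ¬ a < b := by
  intro hab
  have := Order.height_strictMono hab (by simp [ha])
  simp [ha, hb] at this

end

/--
Let `k ≥ 0` and let `P` and `Q` be finite ordered sets with equal marked rank `k`
decks.  If `P` and `Q` each have more than one element of rank `k`; no two distinct
elements of rank `k` of `P` (resp. of `Q`) have both the same strict upper bounds and
the same strict lower bounds; and the induced subposets `P∖P_k` and `Q∖Q_k` on the
complements of the sets of rank-`k` elements are rigid, then `P` and `Q` are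
order-isomorphic.
-/
theorem iso_of_rigid_complement {P Q : Type*}
    [PartialOrder P] [Fintype P] [PartialOrder Q] [Fintype Q] (k : ℕ)
    (hdecks : EqualMarkedRankDecks P Q k)
    (hPbig : ∃ x y : P, x ≠ y ∧ Order.height x = (k : ℕ∞) ∧ Order.height y = (k : ℕ∞))
    (hQbig : ∃ x y : Q, x ≠ y ∧ Order.height x = (k : ℕ∞) ∧ Order.height y = (k : ℕ∞))
    (hPsep : ∀ x y : P, Order.height x = (k : ℕ∞) → Order.height y = (k : ℕ∞) →
      {z : P | x < z} = {z : P | y < z} → {z : P | z < x} = {z : P | z < y} → x = y)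
    (hQsep : ∀ x y : Q, Order.height x = (k : ℕ∞) → Order.height y = (k : ℕ∞) →
      {z : Q | x < z} = {z : Q | y < z} → {z : Q | z < x} = {z : Q | z < y} → x = y)
    (hPrigid : ∀ f : {x : P // Order.height x ≠ (k : ℕ∞)} ≃o
        {x : P // Order.height x ≠ (k : ℕ∞)}, ∀ z, f z = z)
    (hQrigid : ∀ f : {x : Q // Order.height x ≠ (k : ℕ∞)} ≃o
        {x : Q // Order.height x ≠ (k : ℕ∞)}, ∀ z, f z = z) :
    Nonempty (P ≃o Q) := by
  classical
  obtain ⟨σ, hσ⟩ := hdecks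
  choose Φ hΦ using hσ
  have hk : ∀ x z, Order.height (Φ x z).val = (k : ℕ∞) ↔ Order.height z.val = (k : ℕ∞) :=
    fun x z => by rw [hΦ]
  obtain ⟨x₀, x₁, hne, hx₀, hx₁⟩ := hPbig
  let Ψ := fun x : {x : P // Order.height x = (k : ℕ∞)} =>
    cardIsoRestrict (s := fun p => Order.height p = (k : ℕ∞))
      (t := fun q => Order.height q = (k : ℕ∞)) x.2 (σ x).2 (Φ x) (hk x)
  have hΨ : ∀ x, Ψ x = Ψ ⟨x₀, hx₀⟩ := fun x => orderIso_eq_of_rigid hPrigid _ _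
  have hmatch : ∀ x z, HaveMatchingBounds (Ψ ⟨x₀, hx₀⟩) z.val (Φ x z).val := fun x z =>
    hΨ x ▸ haveMatchingBounds_cardIsoRestrict (s := fun p => Order.height p = (k : ℕ∞))
      (t := fun q => Order.height q = (k : ℕ∞)) x.2 (σ x).2 (Φ x) (hk x) z
  refine nonempty_orderIso_of_haveMatchingBounds (Ψ ⟨x₀, hx₀⟩)
    (fun _ _ => not_lt_of_height_eq_coe) (fun _ _ => not_lt_of_height_eq_coe)
    hPsep hQsep (fun x hx => ?_) (fun y hy => ?_)
  · obtain ⟨x', hx'⟩ : ∃ x' : {x : P // Order.height x = (k : ℕ∞)}, x ≠ x'.val := by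
      by_cases h : x = x₀
      · exact ⟨⟨x₁, hx₁⟩, h ▸ hne⟩
      · exact ⟨⟨x₀, hx₀⟩, h⟩
    exact ⟨_, (hk x' ⟨x, hx'⟩).2 hx, hmatch x' ⟨x, hx'⟩⟩
  · obtain ⟨y₀, y₁, hne', hy₀, hy₁⟩ := hQbig
    obtain ⟨y', hy'⟩ : ∃ y' : {y : Q // Order.height y = (k : ℕ∞)}, y ≠ y'.val := by
      by_cases h : y = y₀
      · exact ⟨⟨y₁, hy₁⟩, h ▸ hne'⟩
      · exact ⟨⟨y₀, hy₀⟩, h⟩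
    obtain ⟨x', rfl⟩ := σ.surjective y'
    obtain ⟨z, hz⟩ := (Φ x').surjective ⟨y, hy'⟩
    have hzy : (Φ x' z).val = y := by rw [hz]
    exact ⟨z.val, (hk x' z).1 (hzy ▸ hy), hzy ▸ hmatch x' z⟩
end

section
/- Let P and Q be finite ordered sets and let 0<k<l. Suppose that: the set {x∈P : k ≤ rank_P(x) ≤ l} is a rigid separator of P and the set {x∈Q : k ≤ rank_Q(x) ≤ l} is a rigid separator of Q; there are maximal elements M_P of P and M_Q of Q, both of rank r > l, and an order isomorphism φ: P∖{M_P} → Q∖{M_Q} with rank_Q(φ(x)) = rank_P(x) for all x; and there are minimal elements m_P of P and m_Q of Q and an order isomorphism ψ: P∖{m_P} → Q∖{m_Q} with rank_Q(ψ(x)) = rank_P(x) for all x. Then P is order-isomorphic to Q. -/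
/-- For `0 < k < l`, the subset `{x ∈ P : k ≤ rank x ≤ l}` is a rigid separator iff it
is rigid as an induced subposet, `P` contains elements of rank greater than `l`, and no
element of rank less than `k` is a lower cover of an element of rank greater than `l`.
(The rank of an element is `Order.height`.) -/
def RigidSeparator (P : Type*) [PartialOrder P] (k l : ℕ) : Prop :=
  (∀ f : {x : P // (k : ℕ∞) ≤ Order.height x ∧ Order.height x ≤ (l : ℕ∞)} ≃o
      {x : P // (k : ℕ∞) ≤ Order.height x ∧ Order.height x ≤ (l : ℕ∞)}, ∀ z, f z = z) ∧
  (∃ x : P, (l : ℕ∞) < Order.height x) ∧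
  (∀ x y : P, Order.height x < (k : ℕ∞) → (l : ℕ∞) < Order.height y → ¬ x ⋖ y)

/-- The elements whose rank lies between `k` and `l`. -/
abbrev Levels (P : Type*) [PartialOrder P] (k l : ℕ) : Type _ :=
  {x : P // (k : ℕ∞) ≤ Order.height x ∧ Order.height x ≤ (l : ℕ∞)}

/-- A rank-preserving isomorphism of cards restricts to the levels from `k` to `l` when the
deleted points lie outside these levels. -/
def levelsIso {P Q : Type*} [PartialOrder P] [PartialOrder Q] {k l : ℕ} {a : P} {b : Q}
    (e : Card P a ≃o Card Q b)
    (he : ∀ z : Card P a, Order.height (e z).val = Order.height z.val)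
    (ha : ∀ x : Levels P k l, x.val ≠ a) (hb : ∀ y : Levels Q k l, y.val ≠ b) :
    Levels P k l ≃o Levels Q k l where
  toFun x := ⟨(e ⟨x.val, ha x⟩).val, by rw [he]; exact x.2⟩
  invFun y := ⟨(e.symm ⟨y.val, hb y⟩).val, by
    rw [← he, OrderIso.apply_symm_apply]; exact y.2⟩
  left_inv x := by simp
  right_inv y := by simp
  map_rel_iff' {x y} := e.le_iff_le (x := ⟨x.val, ha x⟩) (y := ⟨y.val, ha y⟩)

/-- A rigid separator meets every interval that starts below it and ends above it. -/
theorem RigidSeparator.exists_between {P : Type*} [PartialOrder P] [Finite P] {k l : ℕ}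
    (h : RigidSeparator P k l) {x y : P} (hx : Order.height x < (k : ℕ∞))
    (hy : (l : ℕ∞) < Order.height y) (hxy : x < y) :
    ∃ w : Levels P k l, x < w.val ∧ w.val < y := by
  induction x using WellFoundedGT.induction with
  | ind x ih =>
    obtain ⟨w, hxw, hwy⟩ := exists_covBy_le_of_lt hxy
    have hwl : Order.height w ≤ (l : ℕ∞) := not_lt.1 fun hw => h.2.2 x w hx hw hxw
    have hwy' : w < y := hwy.lt_of_ne (by rintro rfl; exact hwl.not_gt hy)
    by_cases hwk : (k : ℕ∞) ≤ Order.height w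
    · exact ⟨⟨w, hwk, hwl⟩, hxw.lt, hwy'⟩
    · obtain ⟨v, hwv, hvy⟩ := ih w hxw.lt (not_le.1 hwk) hwy'
      exact ⟨v, hxw.lt.trans hwv, hvy⟩

/--
Let `P` and `Q` be finite ordered sets and `0 < k < l` with
`{x ∈ P : k ≤ rank x ≤ l}` and `{x ∈ Q : k ≤ rank x ≤ l}` rigid separators.  If there
are maximal elements `M_P` of `P` and `M_Q` of `Q`, both of the same rank `r > l`, and
a rank-preserving order isomorphism `φ : P∖{M_P} → Q∖{M_Q}`, and there are minimal
elements `m_P` of `P` and `m_Q` of `Q` and a rank-preserving order isomorphism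
`ψ : P∖{m_P} → Q∖{m_Q}`, then `P` is order-isomorphic to `Q`.
-/
theorem iso_of_rigid_separator {P Q : Type*}
    [PartialOrder P] [Fintype P] [PartialOrder Q] [Fintype Q]
    (k l : ℕ) (hk : 0 < k) (hkl : k < l)
    (hP : RigidSeparator P k l) (hQ : RigidSeparator Q k l)
    (M_P : P) (M_Q : Q) (hMP : IsMax M_P) (hMQ : IsMax M_Q)
    (hMrank : Order.height M_P = Order.height M_Q)
    (hMl : (l : ℕ∞) < Order.height M_P)
    (φ : Card P M_P ≃o Card Q M_Q)
    (hφ : ∀ z : Card P M_P, Order.height (φ z).val = Order.height z.val)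
    (m_P : P) (m_Q : Q) (hmP : IsMin m_P) (hmQ : IsMin m_Q)
    (ψ : Card P m_P ≃o Card Q m_Q)
    (hψ : ∀ z : Card P m_P, Order.height (ψ z).val = Order.height z.val) :
    Nonempty (P ≃o Q) := by
  have hkl' : (k : ℕ∞) < (l : ℕ∞) := by exact_mod_cast hkl
  have hk' : (0 : ℕ∞) < (k : ℕ∞) := by exact_mod_cast hk
  have neM : ∀ x : P, Order.height x ≤ (l : ℕ∞) → x ≠ M_P := by
    rintro x hx rfl; exact hx.not_gt hMl
  have neM' : ∀ x : Q, Order.height x ≤ (l : ℕ∞) → x ≠ M_Q := by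
    rintro x hx rfl; exact hx.not_gt (hMrank ▸ hMl)
  have nem : ∀ x : P, (k : ℕ∞) ≤ Order.height x → x ≠ m_P := by
    rintro x hx rfl; rw [Order.height_eq_zero.2 hmP] at hx; exact hx.not_gt hk'
  have nem' : ∀ x : Q, (k : ℕ∞) ≤ Order.height x → x ≠ m_Q := by
    rintro x hx rfl; rw [Order.height_eq_zero.2 hmQ] at hx; exact hx.not_gt hk'
  let α : Levels P k l ≃o Levels Q k l :=
    levelsIso φ hφ (fun x => neM x x.2.2) (fun y => neM' y y.2.2)
  let β : Levels P k l ≃o Levels Q k l :=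
    levelsIso ψ hψ (fun x => nem x x.2.1) (fun y => nem' y y.2.1)
  have hαβ (x : Levels P k l) : α x = β x := by
    have h := hP.1 (α.trans β.symm) x
    rwa [OrderIso.trans_apply, OrderIso.symm_apply_eq] at h
  have agree (x : P) (h₁ : (k : ℕ∞) ≤ Order.height x) (h₂ : Order.height x ≤ (l : ℕ∞)) :
      (φ ⟨x, neM x h₂⟩).val = (ψ ⟨x, nem x h₁⟩).val :=
    congrArg Subtype.val (hαβ ⟨x, h₁, h₂⟩)
  have high {x : P} (h : ¬ Order.height x ≤ (l : ℕ∞)) : (k : ℕ∞) ≤ Order.height x :=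
    (hkl'.trans (not_le.1 h)).le
  let f (x : P) : Q :=
    if h : Order.height x ≤ (l : ℕ∞) then (φ ⟨x, neM x h⟩).val
    else (ψ ⟨x, nem x (high h)⟩).val
  have f_low (x : P) (h : Order.height x ≤ (l : ℕ∞)) : f x = (φ ⟨x, neM x h⟩).val := dif_pos h
  have f_high (x : P) (h : (k : ℕ∞) ≤ Order.height x) : f x = (ψ ⟨x, nem x h⟩).val := by
    by_cases hx : Order.height x ≤ (l : ℕ∞)
    · rw [f_low x hx, agree x h hx]
    · exact dif_neg hx
  have height_f (x : P) : Order.height (f x) = Order.height x := by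
    by_cases h : Order.height x ≤ (l : ℕ∞)
    · rw [f_low x h, hφ]
    · rw [f_high x (high h), hψ]
  have f_le_low {x y : P} (hx : Order.height x ≤ (l : ℕ∞)) (hy : Order.height y ≤ (l : ℕ∞)) :
      f x ≤ f y ↔ x ≤ y := by
    rw [f_low x hx, f_low y hy, Subtype.coe_le_coe, φ.le_iff_le, Subtype.mk_le_mk]
  have f_le_high {x y : P} (hx : (k : ℕ∞) ≤ Order.height x) (hy : (k : ℕ∞) ≤ Order.height y) :
      f x ≤ f y ↔ x ≤ y := by
    rw [f_high x hx, f_high y hy, Subtype.coe_le_coe, ψ.le_iff_le, Subtype.mk_le_mk]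
  have f_le {x y : P} : f x ≤ f y ↔ x ≤ y := by
    rcases le_or_gt (k : ℕ∞) (Order.height x) with hx | hx
    · rcases le_or_gt (k : ℕ∞) (Order.height y) with hy | hy
      · exact f_le_high hx hy
      · refine iff_of_false (fun h => ?_) (fun h => ?_)
        · have := Order.height_mono h
          rw [height_f, height_f] at this
          exact (hx.trans this).not_gt hy
        · exact (hx.trans (Order.height_mono h)).not_gt hy
    · have hxl : Order.height x ≤ (l : ℕ∞) := (hx.trans hkl').le
      rcases le_or_gt (Order.height y) (l : ℕ∞) with hy | hy
      · exact f_le_low hxl hy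
      · have hyk : (k : ℕ∞) ≤ Order.height y := high hy.not_ge
        constructor <;> intro h
        · have hlt : f x < f y := h.lt_of_ne fun e => by
            have := congrArg Order.height e
            rw [height_f, height_f] at this
            exact (this ▸ hxl).not_gt hy
          obtain ⟨w, hxw, hwy⟩ := hQ.exists_between (by rwa [height_f]) (by rwa [height_f])
            hlt
          obtain ⟨v, rfl⟩ := α.surjective w
          rw [show (α v).val = f v from (f_low v v.2.2).symm] at hxw hwy
          exact ((f_le_low hxl v.2.2).1 hxw.le).trans ((f_le_high v.2.1 hyk).1 hwy.le)
        · have hlt : x < y := h.lt_of_ne (by rintro rfl; exact hxl.not_gt hy)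
          obtain ⟨w, hxw, hwy⟩ := hP.exists_between hx hy hlt
          exact ((f_le_low hxl w.2.2).2 hxw.le).trans ((f_le_high w.2.1 hyk).2 hwy.le)
  have f_surj : Function.Surjective f := by
    intro q
    by_cases hq : Order.height q ≤ (l : ℕ∞)
    · obtain ⟨x, hx⟩ := φ.surjective ⟨q, neM' q hq⟩
      have hxl : Order.height x.val ≤ (l : ℕ∞) := by rw [← hφ, hx]; exact hq
      exact ⟨x.val, by rw [f_low _ hxl]; exact congrArg Subtype.val hx⟩
    · have hqk := (hkl'.trans (not_le.1 hq)).le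
      obtain ⟨x, hx⟩ := ψ.surjective ⟨q, nem' q hqk⟩
      have hxk : (k : ℕ∞) ≤ Order.height x.val := by rw [← hψ, hx]; exact hqk
      exact ⟨x.val, by rw [f_high _ hxk]; exact congrArg Subtype.val hx⟩
  exact ⟨RelIso.ofSurjective (OrderEmbedding.ofMapLEIff f fun _ _ => f_le) f_surj⟩
end
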